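/- Suppose the continuum X is the union of two subcontinua A and B such that the image of every strictly locally 1-to-1 continuous map defined on A is a 2-to-1 retract of a continuum, and the image of every strictly locally 1-to-1 continuous map defined on B is a 2-to-1 retract of a continuum. Then the image of every strictly locally 1-to-1 continuous map defined on X is a 2-to-1 retract of a continuum. -/

import Mathlib

open Set Metric Topology

/-- A subcontinuum of a topological space: a nonempty compact connected subset. -/
def IsSubcontinuum {X : Type*} [TopologicalSpace X] (K : Set X) : Prop :=
  IsCompact K ∧ IsConnected K

/-- The metric space `Y` is an `m`-to-1 retract of a continuum: there is a continuum `X`,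
a subcontinuum `Y'` of `X` homeomorphic to `Y`, and a continuous retraction of `X` onto `Y'`
under which every point of `Y'` has exactly `m` preimages. -/
def IsMToOneRetract (m : ℕ) (Y : Type*) [MetricSpace Y] : Prop :=
  ∃ (X : Type) (_ : MetricSpace X), CompactSpace X ∧ ConnectedSpace X ∧ Nonempty X ∧
    ∃ Y' : Set X, IsSubcontinuum Y' ∧ Nonempty (Y ≃ₜ Y') ∧
      ∃ r : X → X, Continuous r ∧ (∀ x, r x ∈ Y') ∧ (∀ y ∈ Y', r y = y) ∧
        ∀ y ∈ Y', {x : X | r x = y}.ncard = m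

/-- A 1-to-1 cover of a map `f` : a restriction of `f` to an open proper subset `U`
of the domain such that `f` is injective on `U` and `f(U) = f(X)`. -/
def HasOneToOneCover {X Y : Type*} [TopologicalSpace X] (f : X → Y) : Prop :=
  ∃ U : Set X, IsOpen U ∧ U ≠ Set.univ ∧ Set.InjOn f U ∧ f '' U = Set.range f

/-- Strictly locally 1-to-1: locally injective but not injective. -/
def StrictlyLocallyInjective {X Y : Type*} [TopologicalSpace X] (f : X → Y) : Prop :=
  (∀ x : X, ∃ U ∈ 𝓝 x, Set.InjOn f U) ∧ ¬ Function.Injective f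

/-- A map is simple if each point-inverse of a point of the image has cardinality one or two. -/
def SimpleMap {X Y : Type*} (f : X → Y) : Prop :=
  ∀ y ∈ Set.range f, (f ⁻¹' {y}).ncard = 1 ∨ (f ⁻¹' {y}).ncard = 2

/-- `f` is injective on each proper subcontinuum of its domain. -/
def InjOnProperSubcontinua {X Y : Type*} [TopologicalSpace X] (f : X → Y) : Prop :=
  ∀ K : Set X, IsSubcontinuum K → K ≠ Set.univ → Set.InjOn f K

/-- Two sets are separated if neither contains a limit point of the other. -/
def SeparatedSets {X : Type*} [TopologicalSpace X] (A B : Set X) : Prop :=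
  Disjoint (closure A) B ∧ Disjoint A (closure B)

/-- Every subcontinuum with more than one point is the union of two proper subcontinua. -/
def HereditarilyDecomposable (X : Type*) [TopologicalSpace X] : Prop :=
  ∀ K : Set X, IsSubcontinuum K → K.Nontrivial →
    ∃ A B : Set X, IsSubcontinuum A ∧ IsSubcontinuum B ∧
      A ⊆ K ∧ B ⊆ K ∧ A ≠ K ∧ B ≠ K ∧ A ∪ B = K

/-- Arclike: for each `ε > 0` there is an `ε`-map onto `[0,1]`. -/
def Arclike (X : Type*) [MetricSpace X] : Prop :=
  ∀ ε > (0:ℝ), ∃ g : X → ℝ, Continuous g ∧ Set.range g = Set.Icc 0 1 ∧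
    ∀ t : ℝ, Metric.diam (g ⁻¹' {t}) < ε

/-- A tree: a connected finite graph (a continuum that is a finite union of arcs meeting
only at endpoints) containing no simple closed curve. -/
def IsTree (T : Type*) [MetricSpace T] : Prop :=
  CompactSpace T ∧ ConnectedSpace T ∧ Nonempty T ∧
    (∃ (n : ℕ) (γ : Fin n → ℝ → T),
      (∀ i, ContinuousOn (γ i) (Set.Icc 0 1) ∧ Set.InjOn (γ i) (Set.Icc 0 1)) ∧
      (⋃ i, γ i '' Set.Icc 0 1) = Set.univ ∧
      (∀ i j, i ≠ j →
        (γ i '' Set.Icc 0 1) ∩ (γ j '' Set.Icc 0 1) ⊆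
          ({γ i 0, γ i 1, γ j 0, γ j 1} : Set T))) ∧
    ¬ ∃ S : Set T, Nonempty (S ≃ₜ (Metric.sphere (0:ℂ) 1))

/-- Treelike: for each `ε > 0` there is an `ε`-map onto a tree. -/
def Treelike (X : Type*) [MetricSpace X] : Prop :=
  ∀ ε > (0:ℝ), ∃ (T : Type) (_ : MetricSpace T), IsTree T ∧
    ∃ g : X → T, Continuous g ∧ Function.Surjective g ∧
      ∀ t : T, Metric.diam (g ⁻¹' {t}) < ε

/-- A continuum `Y` is a 2-to-1 retract as soon as `Y × ℝ` has a subcontinuum that contains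
`Y × {0}` and has exactly one further point over each point of `Y`. -/
theorem isMToOneRetract_two_of_subcontinuum_prod {Y : Type} [MetricSpace Y] [CompactSpace Y]
    [ConnectedSpace Y] {S : Set (Y × ℝ)} (hS : IsSubcontinuum S) (h0 : ∀ y, (y, (0 : ℝ)) ∈ S)
    (h1 : ∀ y, ∃! t : ℝ, t ≠ 0 ∧ (y, t) ∈ S) : IsMToOneRetract 2 Y := by
  let e : Y → S := fun y => ⟨(y, 0), h0 y⟩
  have he : Continuous e := by fun_prop
  have hinj : Function.Injective e := fun y y' h => congrArg (fun p : S => p.1.1) h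
  refine ⟨S, inferInstance, isCompact_iff_compactSpace.1 hS.1,
    isConnected_iff_connectedSpace.1 hS.2, hS.2.nonempty.to_subtype, range e,
    ⟨isCompact_range he, isConnected_range he⟩,
    ⟨(he.isClosedEmbedding hinj).isEmbedding.toHomeomorph⟩, fun p => e p.1.1, by fun_prop,
    fun p => mem_range_self _, ?_, ?_⟩
  · rintro _ ⟨y, rfl⟩
    rfl
  · rintro _ ⟨y, rfl⟩
    obtain ⟨t, ⟨ht, htS⟩, huniq⟩ := h1 y
    have hfib : {p : S | e p.1.1 = e y} = {e y, ⟨(y, t), htS⟩} := by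
      ext ⟨⟨y', s⟩, hs⟩
      simp only [mem_ofPred_eq, hinj.eq_iff, mem_insert_iff, mem_singleton_iff, Subtype.mk.injEq,
        Prod.mk.injEq, e]
      constructor
      · rintro rfl
        by_cases h : s = 0
        · exact Or.inl ⟨rfl, h⟩
        · exact Or.inr ⟨rfl, huniq s ⟨h, hs⟩⟩
      · rintro (h | h) <;> exact h.1
    rw [hfib, ncard_pair]
    intro h
    exact ht (congrArg (fun p : S => p.1.2) h).symm

/-- The image of a map with a 1-to-1 cover is a 2-to-1 retract. -/
theorem HasOneToOneCover.isMToOneRetract_two {X Y : Type} [MetricSpace X] [CompactSpace X]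
    [ConnectedSpace X] [MetricSpace Y] {f : X → Y} (hf : Continuous f)
    (h : HasOneToOneCover f) : IsMToOneRetract 2 (range f) := by
  obtain ⟨U, hU, hne, hinj, himg⟩ := h
  have hC : IsClosed Uᶜ := hU.isClosed_compl
  have hCne : Uᶜ.Nonempty := nonempty_compl.2 hne
  have : CompactSpace (range f) := isCompact_iff_compactSpace.1 (isCompact_range hf)
  have : ConnectedSpace (range f) := isConnected_iff_connectedSpace.1 (isConnected_range hf)
  let i : range f → range f × ℝ := fun y => (y, 0)
  let j : X → range f × ℝ := fun x => (rangeFactorization f x, infDist x Uᶜ)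
  have hi : Continuous i := by fun_prop
  have hj : Continuous j := hf.rangeFactorization.prodMk (continuous_infDist_pt _)
  have hpos : ∀ x, infDist x Uᶜ ≠ 0 ↔ x ∈ U := fun x => by
    rw [← not_iff_not, not_not, ← hC.mem_iff_infDist_zero hCne, mem_compl_iff]
  refine isMToOneRetract_two_of_subcontinuum_prod (S := range i ∪ range j)
    ⟨(isCompact_range hi).union (isCompact_range hj),
      IsConnected.union ?_ (isConnected_range hi) (isConnected_range hj)⟩
    (fun y => Or.inl ⟨y, rfl⟩) ?_
  · obtain ⟨c, hc⟩ := hCne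
    exact ⟨j c, ⟨rangeFactorization f c, Prod.ext rfl (infDist_zero_of_mem hc).symm⟩, c, rfl⟩
  · rintro ⟨y, hy⟩
    obtain ⟨x, hx, rfl⟩ := himg ▸ hy
    refine ⟨infDist x Uᶜ, ⟨(hpos x).2 hx, Or.inr ⟨x, rfl⟩⟩, ?_⟩
    rintro t ⟨ht, ⟨y', h⟩ | ⟨x', h⟩⟩
    · exact absurd (congrArg Prod.snd h).symm ht
    · obtain rfl : infDist x' Uᶜ = t := congrArg Prod.snd h
      rw [hinj ((hpos x').1 ht) hx (congrArg (fun p => (p.1 : Y)) h)]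

/-- A continuum that contains a subcontinuum which is a 2-to-1 retract is a 2-to-1 retract. -/
theorem IsMToOneRetract.of_subcontinuum {Y : Type} [MetricSpace Y] [CompactSpace Y]
    [ConnectedSpace Y] {K : Set Y} (hK : IsSubcontinuum K) (h : IsMToOneRetract 2 K) :
    IsMToOneRetract 2 Y := by
  obtain ⟨Z, _, _, _, _, K', hK', ⟨φ⟩, r, hr, hrK', hrid, hcard⟩ := h
  have hKne : K.Nonempty := hK.2.nonempty
  have hK'ne : K'.Nonempty := hK'.2.nonempty
  let q : Z → Y := fun z => φ.symm ⟨r z, hrK' z⟩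
  let i : Y → Y × ℝ := fun y => (y, 0)
  let j : Y → Y × ℝ := fun y => (y, infDist y K)
  let k : Z → Y × ℝ := fun z => (q z, infDist z K')
  have hi : Continuous i := by fun_prop
  have hj : Continuous j := continuous_id.prodMk (continuous_infDist_pt _)
  have hq : Continuous q := by fun_prop
  have hk : Continuous k := hq.prodMk (continuous_infDist_pt _)
  have hposY : ∀ y, infDist y K ≠ 0 ↔ y ∉ K := fun y => by
    rw [hK.1.isClosed.mem_iff_infDist_zero hKne]
  have hposZ : ∀ z, infDist z K' ≠ 0 ↔ z ∉ K' := fun z => by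
    rw [hK'.1.isClosed.mem_iff_infDist_zero hK'ne]
  have hqK : ∀ z, q z ∈ K := fun z => (φ.symm _).2
  have hqr : ∀ z (y : K), q z = y ↔ r z = φ y := fun z y => by
    rw [Subtype.coe_inj, φ.symm_apply_eq, Subtype.ext_iff]
  have hfib : ∀ y : K, ∃! z, z ∉ K' ∧ r z = φ y := fun y => by
    have hmem : (φ y : Z) ∈ {z | r z = φ y} := hrid _ (φ y).2
    obtain ⟨z, hz⟩ := ncard_eq_one.1 (ncard_sdiff_singleton_of_mem hmem ▸
      congrArg (· - 1) (hcard _ (φ y).2) :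
        ({z | r z = φ y} \ {(φ y : Z)}).ncard = 1)
    have hiff : ∀ w, (w ∉ K' ∧ r w = φ y) ↔ w = z := fun w => by
      rw [← @mem_singleton_iff _ w z, ← hz, mem_sdiff, mem_singleton_iff, mem_ofPred_eq, and_comm]
      refine and_congr_right fun hw => not_congr ⟨fun h => ?_, fun h => h ▸ (φ y).2⟩
      rw [← hw, hrid w h]
    exact ⟨z, (hiff z).2 rfl, fun w => (hiff w).1⟩
  refine isMToOneRetract_two_of_subcontinuum_prod (S := (range i ∪ range j) ∪ range k)
    ⟨((isCompact_range hi).union (isCompact_range hj)).union (isCompact_range hk),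
      IsConnected.union ?_ (IsConnected.union ?_ (isConnected_range hi) (isConnected_range hj))
        (isConnected_range hk)⟩
    (fun y => Or.inl (Or.inl ⟨y, rfl⟩)) ?_
  · obtain ⟨z, hz⟩ := hK'ne
    exact ⟨k z, Or.inl ⟨q z, Prod.ext rfl (infDist_zero_of_mem hz).symm⟩, z, rfl⟩
  · obtain ⟨y, hy⟩ := hKne
    exact ⟨j y, ⟨y, Prod.ext rfl (infDist_zero_of_mem hy).symm⟩, y, rfl⟩
  · intro y
    by_cases hy : y ∈ K
    · obtain ⟨z, ⟨hz, hzy⟩, huniq⟩ := hfib ⟨y, hy⟩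
      refine ⟨infDist z K', ⟨(hposZ z).2 hz,
        Or.inr ⟨z, Prod.ext ((hqr z ⟨y, hy⟩).2 hzy) rfl⟩⟩, ?_⟩
      rintro t ⟨ht, (⟨y', h⟩ | ⟨y', h⟩) | ⟨z', h⟩⟩
      · exact absurd (congrArg Prod.snd h).symm ht
      · obtain ⟨rfl, rfl⟩ := Prod.mk.inj h
        exact absurd hy ((hposY y').1 ht)
      · obtain ⟨h₁, rfl⟩ := Prod.mk.inj h
        rw [huniq z' ⟨(hposZ z').1 ht, (hqr z' ⟨y, hy⟩).1 h₁⟩]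
    · refine ⟨infDist y K, ⟨(hposY y).2 hy, Or.inl (Or.inr ⟨y, rfl⟩)⟩, ?_⟩
      rintro t ⟨ht, (⟨y', h⟩ | ⟨y', h⟩) | ⟨z', h⟩⟩
      · exact absurd (congrArg Prod.snd h).symm ht
      · obtain ⟨rfl, rfl⟩ := Prod.mk.inj h
        rfl
      · obtain ⟨rfl, rfl⟩ := Prod.mk.inj h
        exact absurd (hqK z') hy

/-- The pairs of distinct points identified by a locally injective continuous map on a compact
space form a compact set. -/
theorem isCompact_setOf_ne_and_eq {X Y : Type*} [TopologicalSpace X] [CompactSpace X]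
    [TopologicalSpace Y] [T2Space Y] {f : X → Y} (hf : Continuous f)
    (hloc : ∀ x, ∃ U ∈ 𝓝 x, InjOn f U) :
    IsCompact {p : X × X | p.1 ≠ p.2 ∧ f p.1 = f p.2} := by
  refine IsClosed.isCompact (isOpen_compl_iff.1 (isOpen_iff_mem_nhds.2 ?_))
  rintro ⟨x, y⟩ hxy
  by_cases h : f x = f y
  · obtain rfl : x = y := by
      by_contra hne
      exact hxy ⟨hne, h⟩
    obtain ⟨U, hU, hinj⟩ := hloc x
    filter_upwards [prod_mem_nhds hU hU] with p hp hp'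
    exact hp'.1 (hinj hp.1 hp.2 hp'.2)
  · have hopen : IsOpen {p : X × X | f p.1 ≠ f p.2} :=
      isOpen_ne_fun (hf.comp continuous_fst) (hf.comp continuous_snd)
    filter_upwards [hopen.mem_nhds h] with p hp hp'
    exact hp hp'.2

/-- A strictly locally injective map on a union of two compact sets on each of which it is
injective has a 1-to-1 cover. -/
theorem StrictlyLocallyInjective.hasOneToOneCover {X Y : Type*} [TopologicalSpace X]
    [CompactSpace X] [T2Space X] [TopologicalSpace Y] [T2Space Y] {f : X → Y}
    (hsl : StrictlyLocallyInjective f) (hf : Continuous f) {A B : Set X} (hA : IsCompact A)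
    (hAB : A ∪ B = univ) (hinjA : InjOn f A) (hinjB : InjOn f B) : HasOneToOneCover f := by
  let C : Set X := {x | x ∈ A ∧ ∃ y, x ≠ y ∧ f x = f y}
  have hC : IsClosed C := by
    have hcomp := ((isCompact_setOf_ne_and_eq hf hsl.1).inter_right
      (hA.isClosed.preimage continuous_fst)).image continuous_fst
    convert hcomp.isClosed using 1
    ext x
    simp [C, and_comm]
  have hcov : ∀ x, x ∉ A → x ∈ B := fun x hx =>
    (hAB.symm ▸ mem_univ x : x ∈ A ∪ B).resolve_left hx
  have key : ∀ x y, x ≠ y → f x = f y → x ∈ A ∨ y ∈ A := fun x y hne h => by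
    by_contra! hcon
    exact hne (hinjB (hcov x hcon.1) (hcov y hcon.2) h)
  refine ⟨Cᶜ, hC.isOpen_compl, nonempty_compl.1 ?_, ?_, ?_⟩
  · rw [compl_compl]
    obtain ⟨x, y, h, hne⟩ : ∃ x y, f x = f y ∧ x ≠ y := by
      simpa [Function.Injective] using hsl.2
    rcases key x y hne h with hx | hy
    · exact ⟨x, hx, y, hne, h⟩
    · exact ⟨y, hy, x, hne.symm, h.symm⟩
  · intro x hx y hy h
    by_contra hne
    rcases key x y hne h with hxA | hyA
    · exact hx ⟨hxA, y, hne, h⟩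
    · exact hy ⟨hyA, x, Ne.symm hne, h.symm⟩
  · refine (image_subset_range f _).antisymm ?_
    rintro _ ⟨x, rfl⟩
    by_cases hx : x ∈ C
    · obtain ⟨hxA, y, hne, h⟩ := hx
      exact ⟨y, fun hy => hne (hinjA hxA hy.1 h), h.symm⟩
    · exact ⟨x, hx, rfl⟩

/-- If `f` is locally injective but not injective on a subcontinuum `A` whose strictly locally
injective images are 2-to-1 retracts, then the image of `f` is a 2-to-1 retract. -/
theorem isMToOneRetract_two_range_of_not_injOn {X Y : Type} [MetricSpace X] [CompactSpace X]
    [ConnectedSpace X] [MetricSpace Y] {A : Set X} (hA : IsSubcontinuum A)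
    (hA2 : ∀ (Z : Type) [MetricSpace Z], ∀ g : A → Z, Continuous g →
      StrictlyLocallyInjective g → IsMToOneRetract 2 (range g))
    {f : X → Y} (hf : Continuous f) (hloc : ∀ x, ∃ U ∈ 𝓝 x, InjOn f U) (hA' : ¬ InjOn f A) :
    IsMToOneRetract 2 (range f) := by
  have : CompactSpace (range f) := isCompact_iff_compactSpace.1 (isCompact_range hf)
  have : ConnectedSpace (range f) := isConnected_iff_connectedSpace.1 (isConnected_range hf)
  have : CompactSpace A := isCompact_iff_compactSpace.1 hA.1
  have : ConnectedSpace A := isConnected_iff_connectedSpace.1 hA.2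
  let g : A → range f := fun a => rangeFactorization f a
  have hg : Continuous g := hf.rangeFactorization.comp continuous_subtype_val
  refine IsMToOneRetract.of_subcontinuum (K := range g)
    ⟨isCompact_range hg, isConnected_range hg⟩ (hA2 _ g hg ⟨fun a => ?_, fun hinj => hA' ?_⟩)
  · obtain ⟨U, hU, hinj⟩ := hloc a
    exact ⟨Subtype.val ⁻¹' U, continuous_subtype_val.continuousAt hU,
      fun x hx y hy h => Subtype.ext (hinj hx hy (congrArg Subtype.val h))⟩
  · intro x hx y hy h
    exact congrArg Subtype.val (@hinj ⟨x, hx⟩ ⟨y, hy⟩ (Subtype.ext h))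

/-- If the continuum `X` is the union of two subcontinua `A` and `B` and every strictly
locally 1-to-1 image of `A` and every strictly locally 1-to-1 image of `B` is a 2-to-1
retract of a continuum, then every strictly locally 1-to-1 image of `X` is a 2-to-1
retract of a continuum. -/
theorem union_of_two_with_retract_images_has_retract_images
    (X : Type) [MetricSpace X] [CompactSpace X] [ConnectedSpace X] [Nonempty X]
    (A B : Set X) (hA : IsSubcontinuum A) (hB : IsSubcontinuum B)
    (hAB : A ∪ B = Set.univ)
    (hA2 : ∀ (Z : Type) [MetricSpace Z], ∀ g : ↥A → Z, Continuous g →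
      StrictlyLocallyInjective g → IsMToOneRetract 2 ↥(Set.range g))
    (hB2 : ∀ (Z : Type) [MetricSpace Z], ∀ g : ↥B → Z, Continuous g →
      StrictlyLocallyInjective g → IsMToOneRetract 2 ↥(Set.range g))
    (Y : Type) [MetricSpace Y] (f : X → Y) (hf : Continuous f)
    (hsl : StrictlyLocallyInjective f) :
    IsMToOneRetract 2 ↥(Set.range f) := by
  by_cases hinjA : InjOn f A
  · by_cases hinjB : InjOn f B
    · exact (hsl.hasOneToOneCover hf hA.1 hAB hinjA hinjB).isMToOneRetract_two hf
    · exact isMToOneRetract_two_range_of_not_injOn hB hB2 hf hsl.1 hinjB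
  · exact isMToOneRetract_two_range_of_not_injOn hA hA2 hf hsl.1 hinjA
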